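/- Let n = 2 and let l_1,…,l_p (p ≥ 3) be pairwise non-proportional nonzero linear forms on ℂ². Then the Bernstein ideal B(A) ⊆ ℂ[s_1,…,s_p] is the principal ideal generated by ( ∏_{i=1}^p (s_i + 1) ) · ( ∏_{j=0}^{2(p−2)} (s_1 + ⋯ + s_p + 2 + j) ). -/

import Mathlib

open MvPolynomial

namespace Arrangement

variable {n : ℕ} {ι : Type} [Fintype ι]

/-- The module `D(A)` of logarithmic derivations of the arrangement defined by
the forms `l i`. -/
noncomputable def DA (l : ι → MvPolynomial (Fin n) ℂ) :
    Submodule (MvPolynomial (Fin n) ℂ)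
      (Derivation ℂ (MvPolynomial (Fin n) ℂ) (MvPolynomial (Fin n) ℂ)) where
  carrier := {χ | ∀ i, χ (l i) ∈ Ideal.span {l i}}
  add_mem' := fun hx hy i => by
    simpa using add_mem (hx i) (hy i)
  zero_mem' := fun i => by simp
  smul_mem' := fun r χ hχ i => by
    simpa using Ideal.mul_mem_left _ r (hχ i)

open Classical in
/-- The property characterizing the family of twisted derivatives
`D i = ∂/∂xᵢ + ∑ⱼ sⱼ (∂lⱼ/∂xᵢ)/lⱼ` acting on the localization
`M = ℂ[x,s,1/F]·l^s`. -/
def IsTwisted (l : ι → MvPolynomial (Fin n) ℂ)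
    (D : Fin n → Module.End ℂ
      (Localization.Away (rename Sum.inl (∏ i, l i) : MvPolynomial (Fin n ⊕ ι) ℂ))) : Prop :=
  (∀ (i : Fin n) (r : MvPolynomial (Fin n ⊕ ι) ℂ)
      (m : Localization.Away (rename Sum.inl (∏ i, l i) : MvPolynomial (Fin n ⊕ ι) ℂ)),
      D i (algebraMap _ _ r * m)
        = algebraMap _ _ (pderiv (Sum.inl i) r) * m + algebraMap _ _ r * D i m) ∧
  (∀ i : Fin n,
      algebraMap (MvPolynomial (Fin n ⊕ ι) ℂ) _ (rename Sum.inl (∏ j, l j)) * D i 1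
        = algebraMap _ _ (∑ j, X (Sum.inr j) *
            rename Sum.inl (pderiv i (l j) * ∏ k ∈ Finset.univ.erase j, l k)))

/-- The algebra `W` of operators on `M`, image of the Weyl algebra
`Aₙ(ℂ)[s₁,…,s_p]` acting on `ℂ[x,s,1/F]·l^s`. -/
noncomputable def Wa (l : ι → MvPolynomial (Fin n) ℂ)
    (D : Fin n → Module.End ℂ
      (Localization.Away (rename Sum.inl (∏ i, l i) : MvPolynomial (Fin n ⊕ ι) ℂ))) :
    Subalgebra ℂ (Module.End ℂ
      (Localization.Away (rename Sum.inl (∏ i, l i) : MvPolynomial (Fin n ⊕ ι) ℂ))) :=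
  Algebra.adjoin ℂ
    ((Set.range fun i : Fin n =>
        LinearMap.mulLeft ℂ (algebraMap _ _ (X (Sum.inl i) : MvPolynomial (Fin n ⊕ ι) ℂ))) ∪
     (Set.range fun j : ι =>
        LinearMap.mulLeft ℂ (algebraMap _ _ (X (Sum.inr j) : MvPolynomial (Fin n ⊕ ι) ℂ))) ∪
     Set.range D)

/-- The Bernstein ideal `B(A)`, as the set of polynomials `b(s₁,…,s_p)` such that
`b · l^s = P · l^{s+1}` for some operator `P` in the Weyl algebra. -/
noncomputable def Bideal (l : ι → MvPolynomial (Fin n) ℂ)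
    (D : Fin n → Module.End ℂ
      (Localization.Away (rename Sum.inl (∏ i, l i) : MvPolynomial (Fin n ⊕ ι) ℂ))) :
    Set (MvPolynomial ι ℂ) :=
  {b | ∃ P ∈ Wa l D,
    algebraMap (MvPolynomial (Fin n ⊕ ι) ℂ) _ ((rename Sum.inr b : MvPolynomial (Fin n ⊕ ι) ℂ))
      = P (algebraMap _ _ (rename Sum.inl (∏ i, l i) : MvPolynomial (Fin n ⊕ ι) ℂ))}

/-- The linear functional on `ℂⁿ` associated to a linear form. -/
noncomputable def toLin (f : MvPolynomial (Fin n) ℂ) : (Fin n → ℂ) →ₗ[ℂ] ℂ :=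
  ∑ i, f.coeff (Finsupp.single i 1) • LinearMap.proj i

/-- The hyperplane `ker lᵢ ⊆ ℂⁿ`. -/
noncomputable def hyp (l : ι → MvPolynomial (Fin n) ℂ) (i : ι) : Submodule ℂ (Fin n → ℂ) :=
  LinearMap.ker (toLin (l i))

open Classical in
/-- The intersection lattice `L(A)`: all intersections of nonempty subfamilies. -/
noncomputable def LA (l : ι → MvPolynomial (Fin n) ℂ) : Finset (Submodule ℂ (Fin n → ℂ)) :=
  (Finset.univ.powerset.filter Finset.Nonempty).image fun I : Finset ι => ⨅ i ∈ I, hyp l i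

open Classical in
/-- `J(X) = {i : X ⊆ ker lᵢ}`. -/
noncomputable def JX (l : ι → MvPolynomial (Fin n) ℂ) (Y : Submodule ℂ (Fin n → ℂ)) :
    Finset ι :=
  Finset.univ.filter fun i => Y ≤ hyp l i

/-- `r(X) = n - dim X`, the codimension. -/
noncomputable def rX (Y : Submodule ℂ (Fin n → ℂ)) : ℕ :=
  n - Module.finrank ℂ Y

/-- Irreducibility of the subarrangement with hyperplanes indexed by `J`. -/
def IrredOn (l : ι → MvPolynomial (Fin n) ℂ) (J : Finset ι) : Prop :=
  ¬ ∃ V₁ V₂ : Submodule ℂ (Fin n → ℂ), IsCompl V₁ V₂ ∧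
      (∀ i ∈ J, V₁ ≤ hyp l i ∨ V₂ ≤ hyp l i) ∧
      (∃ i ∈ J, V₁ ≤ hyp l i) ∧ (∃ i ∈ J, V₂ ≤ hyp l i)

open Classical in
/-- `L'(A) = {X ∈ L(A) : A_X irreducible}`. -/
noncomputable def Lprime (l : ι → MvPolynomial (Fin n) ℂ) :
    Finset (Submodule ℂ (Fin n → ℂ)) :=
  (LA l).filter fun Y => IrredOn l (JX l Y)

/-- The polynomial
`b_A = ∏_{X ∈ L'(A)} ∏_{j=0}^{2(card J(X) − r(X))} ((∑_{i ∈ J(X)} sᵢ) + r(X) + j)`. -/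
noncomputable def bGen (l : ι → MvPolynomial (Fin n) ℂ) : MvPolynomial ι ℂ :=
  ∏ Y ∈ Lprime l, ∏ j ∈ Finset.range (2 * ((JX l Y).card - rX (n := n) Y) + 1),
    ((∑ i ∈ JX l Y, X i) + C ((rX (n := n) Y : ℂ) + (j : ℂ)))

end Arrangement

namespace Arrangement

section LinearForms

/-- An arrangement of central lines in the plane: nonzero, pairwise non-proportional linear
forms. -/
structure IsLineArrangement {ι : Type} (l : ι → MvPolynomial (Fin 2) ℂ) : Prop where
  ne_zero : ∀ i, l i ≠ 0
  homogeneous : ∀ i, (l i).IsHomogeneous 1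
  not_proportional : ∀ i j, i ≠ j → ∀ c : ℂ, l i ≠ c • l j

lemma isHomogeneous_one_eq {f : MvPolynomial (Fin 2) ℂ} (hf : f.IsHomogeneous 1) :
    ∃ a b : ℂ, f = C a * X 0 + C b * X 1 := by
  refine ⟨f.coeff (Finsupp.single 0 1), f.coeff (Finsupp.single 1 1), ?_⟩
  have h : ∀ i, pderiv i f = C (f.coeff (Finsupp.single i 1)) := fun i => by
    have h0 := (hf.pderiv (i := i))
    rw [Nat.sub_self, ← totalDegree_zero_iff_isHomogeneous, totalDegree_eq_zero_iff_eq_C] at h0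
    rw [h0, coeff_pderiv]
    simp
  have h1 := hf.sum_X_mul_pderiv
  rw [Fin.sum_univ_two, h, h, one_smul] at h1
  conv_lhs => rw [← h1]
  ring

/-- A homogeneous polynomial in two variables vanishing at a nonzero zero of a linear form is
divisible by that form. -/
lemma dvd_of_eval_eq_zero {a b : ℂ} (hab : a ≠ 0 ∨ b ≠ 0) {f : MvPolynomial (Fin 2) ℂ} {d : ℕ}
    (hf : f.IsHomogeneous d) (h0 : eval ![b, -a] f = 0) :
    C a * X 0 + C b * X 1 ∣ f := by
  set L : MvPolynomial (Fin 2) ℂ := C a * X 0 + C b * X 1 with hL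
  obtain ⟨u, v, huv⟩ : ∃ u v : ℂ, a * u + b * v = 1 := by
    rcases hab with h | h
    · exact ⟨a⁻¹, 0, by simp [h]⟩
    · exact ⟨0, b⁻¹, by simp [h]⟩
  have huv' : (C a * C u + C b * C v : MvPolynomial (Fin 2) ℂ) = 1 := by
    simp only [← C_mul, ← C_add, huv, C_1]
  set m : MvPolynomial (Fin 2) ℂ := C v * X 0 - C u * X 1 with hm
  have hX : ∀ i, Ideal.Quotient.mk (Ideal.span {L}) (X i) =
      Ideal.Quotient.mk (Ideal.span {L}) (m * C (![b, -a] i)) := by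
    intro i
    rw [Ideal.Quotient.eq, Ideal.mem_span_singleton]
    fin_cases i
    · refine ⟨C u, ?_⟩
      simp only [Fin.zero_eta, Matrix.cons_val_zero, hL, hm]
      linear_combination (-X 0) * huv'
    · refine ⟨C v, ?_⟩
      simp only [Fin.mk_one, Matrix.cons_val_one, Matrix.cons_val_fin_one, hL, hm, C_neg]
      linear_combination (-X 1) * huv'
  have hq : Ideal.Quotient.mk (Ideal.span {L}) f =
      Ideal.Quotient.mk (Ideal.span {L}) (m ^ d * C (eval ![b, -a] f)) := by
    conv_lhs => rw [f.as_sum]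
    conv_rhs => rw [f.as_sum]
    simp only [map_sum, Finset.mul_sum]
    refine Finset.sum_congr rfl fun e he => ?_
    have hde : e 0 + e 1 = d := by
      have := hf.degree_eq_sum_deg_support he
      rw [← Finsupp.degree_apply, Finsupp.degree_eq_sum, Fin.sum_univ_two] at this
      exact this.symm
    rw [monomial_eq, Finsupp.prod_fintype _ _ (by simp), Fin.prod_univ_two, ← hde]
    simp only [map_mul, map_pow, hX, eval_C, eval_X, pow_add]
    ring
  rw [h0, C_0, mul_zero, map_zero, Ideal.Quotient.eq_zero_iff_mem,
    Ideal.mem_span_singleton] at hq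
  exact hq

lemma irreducible_of_isHomogeneous_one {f : MvPolynomial (Fin 2) ℂ} (hf : f.IsHomogeneous 1)
    (h0 : f ≠ 0) : Irreducible f := by
  refine irreducible_of_totalDegree_eq_one (hf.totalDegree h0) fun x hx => ?_
  by_contra hx'
  rw [isUnit_iff_ne_zero, not_not] at hx'
  refine h0 (MvPolynomial.ext _ _ fun m => ?_)
  simpa [hx'] using hx m

/-- Forms of a fixed degree are proportional modulo a linear form. -/
lemma exists_dvd_sub_smul {L f e : MvPolynomial (Fin 2) ℂ} (hL : L.IsHomogeneous 1) (hL0 : L ≠ 0)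
    {d : ℕ} (hf : f.IsHomogeneous d) (he : e.IsHomogeneous d) (hLe : ¬ L ∣ e) :
    ∃ c : ℂ, L ∣ f - C c * e := by
  obtain ⟨a, b, rfl⟩ := isHomogeneous_one_eq hL
  have hab : a ≠ 0 ∨ b ≠ 0 := by
    by_contra! h
    simp [h.1, h.2] at hL0
  have h1 : eval ![b, -a] e ≠ 0 := fun h => hLe (dvd_of_eval_eq_zero hab he h)
  refine ⟨eval ![b, -a] f / eval ![b, -a] e, dvd_of_eval_eq_zero hab (hf.sub (he.C_mul _)) ?_⟩
  simp [h1]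

variable {ι : Type} {l : ι → MvPolynomial (Fin 2) ℂ}

namespace IsLineArrangement

lemma prime (hl : IsLineArrangement l) (i : ι) : Prime (l i) :=
  (irreducible_of_isHomogeneous_one (hl.homogeneous i) (hl.ne_zero i)).prime

lemma not_dvd (hl : IsLineArrangement l) {i j : ι} (hij : i ≠ j) : ¬ l i ∣ l j := by
  intro h
  obtain ⟨u, hu⟩ := ((hl.prime i).irreducible.dvd_irreducible_iff_associated
    (hl.prime j).irreducible).1 h
  obtain ⟨c, -, hc⟩ := MvPolynomial.isUnit_iff_eq_C_of_isReduced.1 u.isUnit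
  refine hl.not_proportional j i hij.symm c ?_
  rw [← hu, hc, smul_eq_C_mul, mul_comm]

lemma isRelPrime (hl : IsLineArrangement l) {i j : ι} (hij : i ≠ j) : IsRelPrime (l i) (l j) :=
  (hl.prime i).irreducible.isRelPrime_iff_not_dvd.2 (hl.not_dvd hij)

lemma prod_dvd (hl : IsLineArrangement l) {s : Finset ι} {f : MvPolynomial (Fin 2) ℂ}
    (h : ∀ i ∈ s, l i ∣ f) : ∏ i ∈ s, l i ∣ f :=
  Finset.prod_dvd_of_isRelPrime (fun _ _ _ _ hij => hl.isRelPrime hij) h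

lemma not_dvd_prod (hl : IsLineArrangement l) {s : Finset ι} {i : ι} (hi : i ∉ s) :
    ¬ l i ∣ ∏ j ∈ s, l j := by
  rw [(hl.prime i).dvd_finsetProd_iff]
  rintro ⟨j, hj, h⟩
  exact hl.not_dvd (by rintro rfl; exact hi hj) h

lemma not_dvd_C (hl : IsLineArrangement l) (i : ι) {c : ℂ} (hc : c ≠ 0) : ¬ l i ∣ C c :=
  fun h => (hl.prime i).not_isUnit (isUnit_of_dvd_unit h ((isUnit_iff_ne_zero.2 hc).map C))

lemma prod_isHomogeneous (hl : IsLineArrangement l) (s : Finset ι) :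
    (∏ i ∈ s, l i).IsHomogeneous s.card := by
  simpa using IsHomogeneous.prod s l (fun _ => 1) fun i _ => hl.homogeneous i

/-- The partial derivatives of a linear form are constant. -/
lemma pderiv_eq_C (hl : IsLineArrangement l) (v : Fin 2) (i : ι) :
    ∃ c : ℂ, pderiv v (l i) = C c := by
  obtain ⟨a, b, h⟩ := isHomogeneous_one_eq (hl.homogeneous i)
  rw [h]
  fin_cases v
  · exact ⟨a, by simp [pderiv_X]⟩
  · exact ⟨b, by simp [pderiv_X]⟩

lemma exists_pderiv_eq_C (hl : IsLineArrangement l) (i : ι) :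
    ∃ v : Fin 2, ∃ c : ℂ, c ≠ 0 ∧ pderiv v (l i) = C c := by
  by_contra! h
  refine hl.ne_zero i ?_
  have h1 := (hl.homogeneous i).sum_X_mul_pderiv
  have h2 : ∀ v, pderiv v (l i) = 0 := fun v => by
    obtain ⟨c, hc⟩ := hl.pderiv_eq_C v i
    by_cases h0 : c = 0
    · rw [hc, h0, C_0]
    · exact absurd hc (h v c h0)
  simpa [h2] using h1.symm

end IsLineArrangement

end LinearForms

section Nabla

variable {ι : Type} [Fintype ι] {l : ι → MvPolynomial (Fin 2) ℂ}

open Classical in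
/-- The product of all the forms except the `j`-th one. -/
noncomputable def cofactor (l : ι → MvPolynomial (Fin 2) ℂ) (j : ι) : MvPolynomial (Fin 2) ℂ :=
  ∏ k ∈ Finset.univ.erase j, l k

lemma mul_cofactor (l : ι → MvPolynomial (Fin 2) ℂ) (j : ι) :
    l j * cofactor l j = ∏ i, l i := by
  classical
  exact Finset.mul_prod_erase _ _ (Finset.mem_univ j)

lemma pderiv_prod (l : ι → MvPolynomial (Fin 2) ℂ) (v : Fin 2) :
    pderiv v (∏ i, l i) = ∑ j, pderiv v (l j) * cofactor l j := by
  classical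
  have key : ∀ s : Finset ι, pderiv v (∏ i ∈ s, l i) =
      ∑ j ∈ s, pderiv v (l j) * ∏ k ∈ s.erase j, l k := fun s => by
    induction s using Finset.induction_on with
    | empty => simp
    | insert a s ha ih =>
      rw [Finset.prod_insert ha, pderiv_mul, ih, Finset.sum_insert ha, Finset.erase_insert ha,
        Finset.mul_sum]
      refine congrArg _ (Finset.sum_congr rfl fun j hj => ?_)
      have hja : a ≠ j := by rintro rfl; exact ha hj
      rw [Finset.erase_insert_of_ne hja, Finset.prod_insert (by simp [ha]), mul_left_comm]
  rw [key]
  refine Finset.sum_congr rfl fun j _ => ?_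
  rw [cofactor]

lemma dvd_cofactor {i j : ι} (hij : i ≠ j) : l i ∣ cofactor l j :=
  Finset.dvd_prod_of_mem _ (by simpa using hij)

/-- The operator `F · (∂_v + ∑ⱼ βⱼ ∂_v(lⱼ) / lⱼ)` on polynomials, where `F = ∏ⱼ lⱼ`. -/
noncomputable def nabla (l : ι → MvPolynomial (Fin 2) ℂ) (β : ι → ℂ) (v : Fin 2) :
    MvPolynomial (Fin 2) ℂ →ₗ[ℂ] MvPolynomial (Fin 2) ℂ :=
  LinearMap.mulLeft ℂ (∏ i, l i) ∘ₗ (pderiv v).toLinearMap +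
    LinearMap.mulLeft ℂ (∑ j, C (β j) * (pderiv v (l j) * cofactor l j))

lemma nabla_apply (β : ι → ℂ) (v : Fin 2) (f : MvPolynomial (Fin 2) ℂ) :
    nabla l β v f = (∏ i, l i) * pderiv v f +
      (∑ j, C (β j) * (pderiv v (l j) * cofactor l j)) * f := rfl

lemma nabla_X_mul (β : ι → ℂ) (v w : Fin 2) (f : MvPolynomial (Fin 2) ℂ) :
    nabla l β v (X w * f) = (∏ i, l i) * (pderiv v (X w) * f) + X w * nabla l β v f := by
  simp only [nabla_apply, pderiv_mul]
  ring

lemma nabla_prod_mul (β : ι → ℂ) (v : Fin 2) (f : MvPolynomial (Fin 2) ℂ) :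
    nabla l β v ((∏ i, l i) * f) = (∏ i, l i) * nabla l (fun i => β i + 1) v f := by
  simp only [nabla_apply, pderiv_mul, pderiv_prod, C_add, C_1, add_mul, one_mul,
    Finset.sum_add_distrib]
  ring

lemma nabla_prod_pow_mul (β : ι → ℂ) (v : Fin 2) (k : ℕ) (f : MvPolynomial (Fin 2) ℂ) :
    nabla l β v ((∏ i, l i) ^ k * f) = (∏ i, l i) ^ k * nabla l (fun i => β i + k) v f := by
  induction k generalizing β with
  | zero => simp
  | succ k ih =>
    rw [pow_succ', mul_assoc, nabla_prod_mul, ih, mul_assoc]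
    congr! 5 with i
    push_cast
    ring

namespace IsLineArrangement

lemma not_dvd_cofactor (hl : IsLineArrangement l) (i : ι) : ¬ l i ∣ cofactor l i :=
  hl.not_dvd_prod (by simp)

lemma prod_ne_zero (hl : IsLineArrangement l) : ∏ i, l i ≠ 0 :=
  Finset.prod_ne_zero_iff.2 fun i _ => hl.ne_zero i

lemma cofactor_isHomogeneous (hl : IsLineArrangement l) (i : ι) :
    (cofactor l i).IsHomogeneous (Fintype.card ι - 1) := by
  classical
  have := hl.prod_isHomogeneous (Finset.univ.erase i)
  rw [Finset.card_erase_of_mem (Finset.mem_univ i), Finset.card_univ] at this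
  convert this
  rw [cofactor]

lemma dvd_of_dvd_nabla (hl : IsLineArrangement l) {β : ι → ℂ} {i : ι} (hi : β i ≠ 0)
    {f : MvPolynomial (Fin 2) ℂ} (hf : ∀ v, l i ∣ nabla l β v f) : l i ∣ f := by
  classical
  obtain ⟨v, c, hc, hv⟩ := hl.exists_pderiv_eq_C i
  have h1 := hf v
  rw [nabla_apply, dvd_add_right ((Finset.dvd_prod_of_mem l (Finset.mem_univ i)).mul_right _),
    ← Finset.add_sum_erase _ _ (Finset.mem_univ i), add_mul, dvd_add_left] at h1
  · rw [hv, ← mul_assoc, ← C_mul] at h1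
    rcases (hl.prime i).dvd_or_dvd h1 with h | h
    · rcases (hl.prime i).dvd_or_dvd h with h | h
      · exact absurd h (hl.not_dvd_C i (mul_ne_zero hi hc))
      · exact absurd h (hl.not_dvd_cofactor i)
    · exact h
  · refine Dvd.dvd.mul_right (Finset.dvd_sum fun j hj => ?_) _
    exact ((dvd_cofactor (Finset.ne_of_mem_erase hj).symm).mul_left _).mul_left _

lemma prod_pow_dvd_of_dvd_nabla (hl : IsLineArrangement l) {β : ι → ℂ}
    (hβ : ∀ i (n : ℕ), β i + n ≠ 0) {k : ℕ} {f : MvPolynomial (Fin 2) ℂ}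
    (hf : ∀ v, (∏ i, l i) ^ k ∣ nabla l β v f) : (∏ i, l i) ^ k ∣ f := by
  induction k generalizing β f with
  | zero => simp
  | succ k ih =>
    obtain ⟨g, rfl⟩ : ∏ i, l i ∣ f := hl.prod_dvd fun i _ =>
      hl.dvd_of_dvd_nabla (by simpa using hβ i 0) fun v =>
        ((Finset.dvd_prod_of_mem l (Finset.mem_univ i)).trans
          (dvd_pow_self _ k.succ_ne_zero)).trans (hf v)
    rw [pow_succ']
    refine mul_dvd_mul_left _ (ih (β := fun i => β i + 1) (fun i n => ?_) fun v => ?_)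
    · have := hβ i (n + 1)
      push_cast at this
      rwa [add_assoc, add_comm 1]
    · have := hf v
      rwa [nabla_prod_mul, pow_succ', mul_dvd_mul_iff_left hl.prod_ne_zero] at this

lemma nabla_isHomogeneous (hl : IsLineArrangement l) [Nonempty ι] (β : ι → ℂ) (v : Fin 2) {n : ℕ}
    {f : MvPolynomial (Fin 2) ℂ} (hf : f.IsHomogeneous n) :
    (nabla l β v f).IsHomogeneous (n + (Fintype.card ι - 1)) := by
  have hp : 0 < Fintype.card ι := Fintype.card_pos
  rw [nabla_apply]
  refine IsHomogeneous.add ?_ ?_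
  · cases n with
    | zero =>
      rw [← totalDegree_zero_iff_isHomogeneous, totalDegree_eq_zero_iff_eq_C] at hf
      rw [hf, pderiv_C, mul_zero]
      exact isHomogeneous_zero _ _ _
    | succ n =>
      convert (hl.prod_isHomogeneous Finset.univ).mul hf.pderiv using 1
      rw [Finset.card_univ]
      omega
  · rw [add_comm]
    refine IsHomogeneous.mul (IsHomogeneous.sum _ _ _ fun j _ => ?_) hf
    obtain ⟨c, hc⟩ := hl.pderiv_eq_C v j
    rw [hc]
    exact ((hl.cofactor_isHomogeneous j).C_mul _).C_mul _

lemma sum_X_mul_nabla (hl : IsLineArrangement l) (β : ι → ℂ) {n : ℕ}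
    {f : MvPolynomial (Fin 2) ℂ} (hf : f.IsHomogeneous n) :
    X 0 * nabla l β 0 f + X 1 * nabla l β 1 f = C (n + ∑ i, β i) * ((∏ i, l i) * f) := by
  have h1 := hf.sum_X_mul_pderiv
  rw [Fin.sum_univ_two, nsmul_eq_mul] at h1
  have h2 : ∀ j, X 0 * pderiv 0 (l j) + X 1 * pderiv 1 (l j) = l j := fun j => by
    simpa using (hl.homogeneous j).sum_X_mul_pderiv
  have h3 : X 0 * (∑ j, C (β j) * (pderiv 0 (l j) * cofactor l j)) +
      X 1 * (∑ j, C (β j) * (pderiv 1 (l j) * cofactor l j)) = C (∑ i, β i) * ∏ i, l i := by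
    rw [Finset.mul_sum, Finset.mul_sum, ← Finset.sum_add_distrib, map_sum, Finset.sum_mul]
    refine Finset.sum_congr rfl fun j _ => ?_
    rw [← mul_cofactor l j]
    linear_combination C (β j) * cofactor l j * h2 j
  rw [nabla_apply, nabla_apply, C_add, map_natCast]
  linear_combination (∏ i, l i) * h1 + f * h3

/-- Contracting a relation `h = ∂₀ u + ∂₁ v` of twisted degree `-2` with the Euler field. -/
lemma nabla_contraction (hl : IsLineArrangement l) {β : ι → ℂ} {n : ℕ} (hn : n + ∑ i, β i = -1)
    {u v : MvPolynomial (Fin 2) ℂ} (hu : u.IsHomogeneous n) (hv : v.IsHomogeneous n) :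
    nabla l β 0 (X 1 * u - X 0 * v) = X 1 * (nabla l β 0 u + nabla l β 1 v) ∧
    nabla l β 1 (X 1 * u - X 0 * v) = -(X 0 * (nabla l β 0 u + nabla l β 1 v)) := by
  have h1 := hl.sum_X_mul_nabla β hu
  have h2 := hl.sum_X_mul_nabla β hv
  rw [hn, C_neg, C_1] at h1 h2
  simp only [map_sub, nabla_X_mul, pderiv_X_self, pderiv_X_of_ne (zero_ne_one' (Fin 2)),
    pderiv_X_of_ne (one_ne_zero' (Fin 2))]
  constructor
  · linear_combination -h2
  · linear_combination h1

end IsLineArrangement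

lemma homogeneousComponent_map {σ : Type*}
    (T : MvPolynomial σ ℂ →ₗ[ℂ] MvPolynomial σ ℂ) (e : ℕ)
    (hT : ∀ n f, f.IsHomogeneous n → (T f).IsHomogeneous (n + e)) (n : ℕ) (f : MvPolynomial σ ℂ) :
    homogeneousComponent (n + e) (T f) = T (homogeneousComponent n f) := by
  have key : ∀ i, homogeneousComponent (n + e) (T (homogeneousComponent i f)) =
      T (homogeneousComponent n (homogeneousComponent i f)) := fun i => by
    have hi := homogeneousComponent_isHomogeneous i f
    rw [homogeneousComponent_of_mem (hT i _ hi), homogeneousComponent_of_mem hi]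
    simp only [Nat.add_right_cancel_iff]
    split_ifs <;> simp
  conv_lhs => rw [← sum_homogeneousComponent f]
  conv_rhs => rw [← sum_homogeneousComponent f]
  simp only [map_sum, key]

lemma dvd_homogeneousComponent_mul {σ : Type*} {r : MvPolynomial σ ℂ} {d : ℕ}
    (hr : r.IsHomogeneous d) (n : ℕ) (f : MvPolynomial σ ℂ) :
    r ∣ homogeneousComponent n (r * f) := by
  rw [← sum_homogeneousComponent f, Finset.mul_sum, map_sum]
  refine Finset.dvd_sum fun i _ => ?_
  rw [homogeneousComponent_of_mem (hr.mul (homogeneousComponent_isHomogeneous i f))]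
  split_ifs <;> simp

/-- For a non-integral exponent `α` of weight `-2 - j` with `j ≤ 2 (p - 2)`, not every polynomial
is exact modulo `F`. -/
lemma IsLineArrangement.eq_zero_of_forall_exact (hl : IsLineArrangement l)
    (hp : 3 ≤ Fintype.card ι) {j : ℕ} (hj : j ≤ 2 * (Fintype.card ι - 2)) {α : ι → ℂ}
    (hα : ∀ i (z : ℤ), α i ≠ z) (hsum : ∑ i, α i = -2 - j) {b : ℂ}
    (h : ∀ γ : MvPolynomial (Fin 2) ℂ, ∃ (k : ℕ) (g u v : MvPolynomial (Fin 2) ℂ),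
      (∏ i, l i) ^ (k + 1) * (C b * γ - (∏ i, l i) * g) =
        nabla l (fun i => α i - k) 0 u + nabla l (fun i => α i - k) 1 v) : b = 0 := by
  classical
  by_contra hb
  set p := Fintype.card ι with hpdef
  have : Nonempty ι := Fintype.card_pos_iff.1 (by omega)
  obtain ⟨i₀, i₁, hi⟩ := Fintype.exists_pair_of_one_lt_card (α := ι) (by omega)
  obtain ⟨S, hS, hcard⟩ := Finset.exists_subset_card_eq
    (s := Finset.univ.erase i₀) (n := min j (p - 1))
    (by rw [Finset.card_erase_of_mem (Finset.mem_univ _), Finset.card_univ]; omega)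
  have hi₀ : i₀ ∉ S := fun h' => by simpa using hS h'
  set γ := (∏ i ∈ S, l i) * l i₁ ^ (j - S.card) with hγ
  have hγdeg : γ.IsHomogeneous j := by
    convert (hl.prod_isHomogeneous S).mul ((hl.homogeneous i₁).pow (j - S.card)) using 1
    omega
  have hγ₀ : ¬ l i₀ ∣ γ := fun h' => by
    rcases (hl.prime i₀).dvd_or_dvd h' with h' | h'
    · exact hl.not_dvd_prod hi₀ h'
    · exact hl.not_dvd hi ((hl.prime i₀).dvd_of_dvd_pow h')
  have hF : (∏ i, l i).IsHomogeneous p := hl.prod_isHomogeneous Finset.univ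
  obtain ⟨k, g, u, v, huv⟩ := h γ
  set β : ι → ℂ := fun i => α i - k with hβ
  have hβsum : ((k * p + j + 1 : ℕ) : ℂ) + ∑ i, β i = -1 := by
    simp only [hβ, Finset.sum_sub_distrib, hsum, Finset.sum_const, Finset.card_univ, ← hpdef,
      nsmul_eq_mul]
    push_cast
    ring
  set u' := homogeneousComponent (k * p + j + 1) u with hu'
  set v' := homogeneousComponent (k * p + j + 1) v with hv'
  obtain ⟨g', hg'⟩ := dvd_homogeneousComponent_mul (hF.pow (k + 2))
    (k * p + j + 1 + (p - 1)) g
  set H := C b * γ - (∏ i, l i) * g' with hH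
  have hrel : (∏ i, l i) ^ (k + 1) * H = nabla l β 0 u' + nabla l β 1 v' := by
    rw [hu', hv', ← homogeneousComponent_map (nabla l β 0) (p - 1)
      (fun n f hf => hl.nabla_isHomogeneous β 0 hf), ← homogeneousComponent_map (nabla l β 1) (p - 1)
      (fun n f hf => hl.nabla_isHomogeneous β 1 hf), ← map_add, ← huv]
    have h1 : ((∏ i, l i) ^ (k + 1) * (C b * γ)).IsHomogeneous (k * p + j + 1 + (p - 1)) := by
      convert (hF.pow (k + 1)).mul (hγdeg.C_mul b) using 1
      rw [mul_add, mul_one, mul_comm p k]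
      omega
    have h2 : (∏ i, l i) ^ (k + 1) * (C b * γ - (∏ i, l i) * g) =
        (∏ i, l i) ^ (k + 1) * (C b * γ) - (∏ i, l i) ^ (k + 2) * g := by ring
    rw [h2, map_sub, hg', homogeneousComponent_eq_self h1]
    ring
  have hudeg := homogeneousComponent_isHomogeneous (k * p + j + 1) u
  have hvdeg := homogeneousComponent_isHomogeneous (k * p + j + 1) v
  obtain ⟨hw0, hw1⟩ := hl.nabla_contraction hβsum hudeg hvdeg
  rw [← hu', ← hv', ← hrel] at hw0 hw1
  set w := X 1 * u' - X 0 * v' with hw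
  have hwdeg : w.IsHomogeneous (k * p + j + 2) := by
    have h0 := ((isHomogeneous_X ℂ (1 : Fin 2)).mul hudeg).sub
      ((isHomogeneous_X ℂ (0 : Fin 2)).mul hvdeg)
    rwa [show 1 + (k * p + j + 1) = k * p + j + 2 by omega] at h0
  have hFk : (∏ i, l i) ^ (k + 1) ≠ 0 := pow_ne_zero _ hl.prod_ne_zero
  obtain ⟨q, hq⟩ : (∏ i, l i) ^ (k + 1) ∣ w := by
    refine hl.prod_pow_dvd_of_dvd_nabla (β := β) (fun i n h0 => ?_) fun v => ?_
    · refine hα i ((k : ℤ) - n) ?_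
      push_cast
      simp only [hβ] at h0
      linear_combination h0
    · fin_cases v
      · exact ⟨X 1 * H, by rw [Fin.zero_eta, hw0]; ring⟩
      · exact ⟨-(X 0 * H), by rw [Fin.mk_one, hw1]; ring⟩
  rw [hq, nabla_prod_pow_mul] at hw0 hw1
  have hq0 := mul_left_cancel₀ hFk (hw0.trans (mul_left_comm _ _ _))
  have hq1 := mul_left_cancel₀ hFk
    (hw1.trans (by ring : _ = (∏ i, l i) ^ (k + 1) * -(X 0 * H)))
  obtain ⟨r, hr⟩ : ∏ i ∈ S, l i ∣ q := by
    refine hl.prod_dvd fun i hiS => hl.dvd_of_dvd_nabla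
      (β := fun i => β i + ((k + 1 : ℕ) : ℂ)) ?_ fun v => ?_
    · intro h0
      refine hα i (-1) ?_
      simp only [hβ] at h0
      push_cast at h0 ⊢
      linear_combination h0
    · have hHi : l i ∣ H := dvd_sub (((Finset.dvd_prod_of_mem l hiS).mul_right _).mul_left _)
        ((Finset.dvd_prod_of_mem l (Finset.mem_univ i)).mul_right _)
      fin_cases v
      · exact hq0 ▸ hHi.mul_left _
      · exact hq1 ▸ (hHi.mul_left _).neg_right
  have hw_zero : w = 0 := by
    by_contra hw_ne
    rw [hr, ← mul_assoc] at hq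
    have hmul := (hF.pow (k + 1)).mul (hl.prod_isHomogeneous S)
    have hle := totalDegree_le_of_dvd_of_isDomain (Dvd.intro r hq.symm) hw_ne
    rw [hwdeg.totalDegree hw_ne, hmul.totalDegree (fun h0 => hw_ne (by rw [hq, h0, zero_mul])),
      hcard, mul_add, mul_one, mul_comm p k] at hle
    omega
  have hq_zero : q = 0 := by simpa [hw_zero, hFk, hl.prod_ne_zero] using hq.symm
  have hH_zero : H = 0 := by simpa [hq_zero] using hq0.symm
  have hdvd : l i₀ ∣ C b * γ := by
    rw [sub_eq_zero.1 hH_zero]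
    exact (Finset.dvd_prod_of_mem l (Finset.mem_univ i₀)).mul_right _
  rcases (hl.prime i₀).dvd_or_dvd hdvd with h' | h'
  · exact hl.not_dvd_C i₀ hb h'
  · exact hγ₀ h'

end Nabla

section Specialization

variable {ι : Type}

/-- Specialization of the parameters `s` at `α`. -/
noncomputable def specialize (α : ι → ℂ) :
    MvPolynomial (Fin 2 ⊕ ι) ℂ →ₐ[ℂ] MvPolynomial (Fin 2) ℂ :=
  aeval (Sum.elim X (C ∘ α))

lemma specialize_inl (α : ι → ℂ) (f : MvPolynomial (Fin 2) ℂ) :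
    specialize α (rename Sum.inl f) = f := by
  rw [specialize, aeval_rename, Sum.elim_comp_inl, aeval_X_left_apply]

lemma specialize_inr (α : ι → ℂ) (b : MvPolynomial ι ℂ) :
    specialize α (rename Sum.inr b) = C (eval α b) := by
  rw [specialize, aeval_rename, Sum.elim_comp_inr]
  induction b using MvPolynomial.induction_on with
  | C a => simp
  | add p q hp hq => rw [map_add, map_add, map_add, hp, hq]
  | mul_X p i h =>
    rw [map_mul, h, aeval_X, map_mul, eval_X, C_mul]
    rfl

lemma specialize_pderiv (α : ι → ℂ) (v : Fin 2) (r : MvPolynomial (Fin 2 ⊕ ι) ℂ) :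
    specialize α (pderiv (Sum.inl v) r) = pderiv v (specialize α r) :=
  aeval_sumElim_pderiv_inl r α v

lemma pderiv_inl_rename_inr (v : Fin 2) (b : MvPolynomial ι ℂ) :
    pderiv (Sum.inl v) (rename Sum.inr b : MvPolynomial (Fin 2 ⊕ ι) ℂ) = 0 := by
  induction b using MvPolynomial.induction_on with
  | C a => simp
  | add p q hp hq => simp [hp, hq]
  | mul_X p i h => simp [h, pderiv_X_of_ne]

/-- A polynomial which vanishes on a Zariski dense part of the graph `X i = r` is divisible
by `X i - r`. -/
lemma X_sub_dvd [DecidableEq ι] {i : ι} {r b : MvPolynomial ι ℂ} {T : Set ℂ} (hT : T.Infinite)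
    (h : ∀ α : ι → ℂ, (∀ k, α k ∈ T) → eval (Function.update α i (eval α r)) b = 0) :
    X i - r ∣ b := by
  have h0 : aeval (Function.update X i r) b = (0 : MvPolynomial ι ℂ) := by
    refine funext_set (fun _ => T) (fun _ => hT) fun α hα => ?_
    rw [map_zero, ← h α fun k => hα k (Set.mem_univ k)]
    have hev : ∀ k, eval α (Function.update X i r k) = Function.update α i (eval α r) k :=
      fun k => by
        rcases eq_or_ne k i with rfl | hk
        · simp
        · simp [Function.update_of_ne hk]
    clear h
    induction b using MvPolynomial.induction_on with
    | C a => simp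
    | add p q hp hq => rw [map_add, map_add, map_add, hp, hq]
    | mul_X p k hp => rw [map_mul, map_mul, map_mul, hp, aeval_X, eval_X, hev]
  have h1 : Ideal.Quotient.mkₐ ℂ (Ideal.span {X i - r}) b =
      Ideal.Quotient.mkₐ ℂ (Ideal.span {X i - r}) (aeval (Function.update X i r) b) := by
    rw [← AlgHom.comp_apply]
    congr 1
    refine MvPolynomial.algHom_ext fun k => ?_
    rw [AlgHom.comp_apply, aeval_X]
    rcases eq_or_ne k i with rfl | hk
    · rw [Function.update_self, Ideal.Quotient.mkₐ_eq_mk, Ideal.Quotient.eq]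
      exact Ideal.mem_span_singleton_self _
    · rw [Function.update_of_ne hk]
  rw [h0, map_zero, Ideal.Quotient.mkₐ_eq_mk, Ideal.Quotient.eq_zero_iff_mem,
    Ideal.mem_span_singleton] at h1
  exact h1

end Specialization

section Localization

variable {ι : Type} [Fintype ι] {l : ι → MvPolynomial (Fin 2) ℂ}

/-- The localization `ℂ[x, s, 1/F]`. -/
abbrev Loc (l : ι → MvPolynomial (Fin 2) ℂ) : Type :=
  Localization.Away (rename Sum.inl (∏ i, l i) : MvPolynomial (Fin 2 ⊕ ι) ℂ)

/-- The canonical map `ℂ[x, s] → ℂ[x, s, 1/F]`. -/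
noncomputable abbrev toLoc (l : ι → MvPolynomial (Fin 2) ℂ) :
    MvPolynomial (Fin 2 ⊕ ι) ℂ →+* Loc l :=
  algebraMap _ _

/-- The product `F` of the forms, as a polynomial in `x` and `s`. -/
noncomputable abbrev prodForm (l : ι → MvPolynomial (Fin 2) ℂ) : MvPolynomial (Fin 2 ⊕ ι) ℂ :=
  rename Sum.inl (∏ i, l i)

/-- The polynomial `F · ∑ⱼ sⱼ ∂_v(lⱼ) / lⱼ`. -/
noncomputable def logForm (l : ι → MvPolynomial (Fin 2) ℂ) (v : Fin 2) :
    MvPolynomial (Fin 2 ⊕ ι) ℂ :=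
  ∑ j, X (Sum.inr j) * rename Sum.inl (pderiv v (l j) * cofactor l j)

lemma pderiv_prodForm (v : Fin 2) : pderiv (Sum.inl v) (prodForm l) =
    ∑ j, rename Sum.inl (pderiv v (l j) * cofactor l j) := by
  rw [prodForm, pderiv_rename Sum.inl_injective, pderiv_prod, map_sum]

lemma isUnit_toLoc_prodForm : IsUnit (toLoc l (prodForm l)) :=
  IsLocalization.Away.algebraMap_isUnit _

lemma IsLineArrangement.toLoc_injective (hl : IsLineArrangement l) :
    Function.Injective (toLoc l) := by
  refine IsLocalization.injective (Loc l) (M := Submonoid.powers (prodForm l)) ?_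
  refine powers_le_nonZeroDivisors_of_noZeroDivisors ?_
  exact (map_ne_zero_iff _ (rename_injective _ Sum.inl_injective)).2 hl.prod_ne_zero

lemma exists_toLoc_eq (m : Loc l) :
    ∃ (k : ℕ) (r : MvPolynomial (Fin 2 ⊕ ι) ℂ), toLoc l (prodForm l) ^ k * m = toLoc l r := by
  obtain ⟨k, r, h⟩ := IsLocalization.Away.surj (prodForm l) m
  exact ⟨k, r, by rw [mul_comm, ← h]⟩

lemma toLoc_C_mul (c : ℂ) (m : Loc l) : toLoc l (C c) * m = c • m := by
  rw [← algebraMap_eq, ← IsScalarTower.algebraMap_apply, Algebra.smul_def]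

variable {D : Fin 2 → Module.End ℂ (Loc l)}

lemma IsTwisted.apply_mul (hD : IsTwisted l D) (v : Fin 2) (r : MvPolynomial (Fin 2 ⊕ ι) ℂ)
    (m : Loc l) :
    D v (toLoc l r * m) = toLoc l (pderiv (Sum.inl v) r) * m + toLoc l r * D v m :=
  hD.1 v r m

lemma IsTwisted.prodForm_mul_one (hD : IsTwisted l D) (v : Fin 2) :
    toLoc l (prodForm l) * D v 1 = toLoc l (logForm l v) :=
  hD.2 v

lemma IsTwisted.apply_toLoc (hD : IsTwisted l D) (v : Fin 2) (r : MvPolynomial (Fin 2 ⊕ ι) ℂ) :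
    D v (toLoc l r) = toLoc l (pderiv (Sum.inl v) r) + toLoc l r * D v 1 := by
  simpa using hD.apply_mul v r 1

/-- The action of `D v` on fractions with denominator `F ^ k`, specialized at `s = α`. -/
lemma IsTwisted.exists_numerator (hD : IsTwisted l D) (α : ι → ℂ) (v : Fin 2) {k : ℕ} {m : Loc l}
    {r : MvPolynomial (Fin 2 ⊕ ι) ℂ} (h : toLoc l (prodForm l) ^ k * m = toLoc l r) :
    ∃ r', toLoc l (prodForm l) ^ (k + 1) * D v m = toLoc l r' ∧
      specialize α r' = nabla l (fun i => α i - k) v (specialize α r) := by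
  refine ⟨prodForm l * pderiv (Sum.inl v) r + r * logForm l v -
    k * (r * pderiv (Sum.inl v) (prodForm l)), ?_, ?_⟩
  · have h1 : D v (toLoc l (prodForm l ^ k) * m) = D v (toLoc l r) := by rw [map_pow, h]
    rw [hD.apply_mul, hD.apply_toLoc, pderiv_pow] at h1
    have h2 := hD.prodForm_mul_one v
    simp only [map_add, map_sub, map_mul, map_pow, map_natCast] at h1 ⊢
    have h3 : (k : Loc l) * toLoc l (prodForm l) ^ (k - 1) * toLoc l (prodForm l) =
        k * toLoc l (prodForm l) ^ k := by
      cases k <;> simp [pow_succ, mul_assoc]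
    linear_combination toLoc l (prodForm l) * h1 + toLoc l r * h2 -
      toLoc l (pderiv (Sum.inl v) (prodForm l)) * m * h3 -
      k * toLoc l (pderiv (Sum.inl v) (prodForm l)) * h
  · rw [pderiv_prodForm, nabla_apply]
    simp only [map_add, map_sub, map_mul, map_natCast, specialize_pderiv, specialize_inl,
      map_sum, logForm, sub_mul, Finset.sum_sub_distrib, ← Finset.mul_sum]
    have h4 : ∀ j, specialize α (X (Sum.inr j)) = C (α j) := fun j => by simp [specialize]
    simp only [h4]
    ring

lemma Wa_induction (T : Submodule ℂ (Loc l))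
    (hX : ∀ z, ∀ m ∈ T, toLoc l (X z) * m ∈ T) (hT : ∀ v, ∀ m ∈ T, D v m ∈ T)
    {P : Module.End ℂ (Loc l)} (hP : P ∈ Wa l D) : ∀ m ∈ T, P m ∈ T := by
  refine Algebra.adjoin_induction (fun P hP m hm => ?_) (fun c m hm => ?_)
    (fun P Q _ _ hP hQ m hm => ?_) (fun P Q _ _ hP hQ m hm => ?_) hP
  · rcases hP with (⟨i, rfl⟩ | ⟨j, rfl⟩) | ⟨v, rfl⟩
    · exact hX _ m hm
    · exact hX _ m hm
    · exact hT v m hm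
  · exact T.smul_mem c hm
  · exact T.add_mem (hP m hm) (hQ m hm)
  · exact hP _ (hQ m hm)

end Localization

section Necessity

variable {ι : Type} [Fintype ι] {l : ι → MvPolynomial (Fin 2) ℂ} {D : Fin 2 → Module.End ℂ (Loc l)}

/-- The elements whose specialization at `s = α` has a zero along `l i`, up to the factor
`l_i ^ α_i` with `α_i = -1`. -/
def vanishingSubmodule (l : ι → MvPolynomial (Fin 2) ℂ) (α : ι → ℂ) (i : ι) :
    Submodule ℂ (Loc l) where
  carrier := {m | ∃ (k : ℕ) (r : MvPolynomial (Fin 2 ⊕ ι) ℂ),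
    toLoc l (prodForm l) ^ k * m = toLoc l r ∧ l i ^ (k + 1) ∣ specialize α r}
  zero_mem' := ⟨0, 0, by simp, by simp⟩
  add_mem' := by
    rintro m₁ m₂ ⟨k₁, r₁, h₁, hr₁⟩ ⟨k₂, r₂, h₂, hr₂⟩
    have hF : l i ∣ ∏ j, l j := Finset.dvd_prod_of_mem l (Finset.mem_univ i)
    refine ⟨k₁ + k₂, prodForm l ^ k₂ * r₁ + prodForm l ^ k₁ * r₂, ?_, ?_⟩
    · simp only [map_add, map_mul, map_pow, pow_add]
      linear_combination toLoc l (prodForm l) ^ k₂ * h₁ + toLoc l (prodForm l) ^ k₁ * h₂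
    · simp only [map_add, map_mul, map_pow, specialize_inl]
      refine dvd_add ?_ ?_
      · rw [show k₁ + k₂ + 1 = k₂ + (k₁ + 1) by ring, pow_add]
        exact mul_dvd_mul (pow_dvd_pow_of_dvd hF _) hr₁
      · rw [add_assoc, pow_add]
        exact mul_dvd_mul (pow_dvd_pow_of_dvd hF _) hr₂
  smul_mem' := by
    rintro c m ⟨k, r, h, hr⟩
    refine ⟨k, C c * r, ?_, ?_⟩
    · rw [← toLoc_C_mul, map_mul, ← h, mul_left_comm]
    · rw [map_mul]
      exact hr.mul_left _

/-- The pole order along `l i` is governed by the exponent `β i`. -/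
lemma pow_dvd_nabla {β : ι → ℂ} {i : ι} {k : ℕ} (hi : β i = -(k + 1))
    {f : MvPolynomial (Fin 2) ℂ} (hf : l i ^ (k + 1) ∣ f) (v : Fin 2) :
    l i ^ (k + 2) ∣ nabla l β v f := by
  classical
  obtain ⟨g, rfl⟩ := hf
  obtain ⟨c, hc⟩ : l i ∣ ∑ j ∈ Finset.univ.erase i, C (β j) * (pderiv v (l j) * cofactor l j) :=
    Finset.dvd_sum fun j hj =>
      ((dvd_cofactor (Finset.ne_of_mem_erase hj).symm).mul_left _).mul_left _
  refine ⟨cofactor l i * pderiv v g + c * g, ?_⟩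
  rw [nabla_apply, ← Finset.add_sum_erase _ _ (Finset.mem_univ i), hc, hi, ← mul_cofactor l i,
    pderiv_mul, pderiv_pow, C_neg, C_add, C_1, map_natCast, Nat.add_sub_cancel]
  push_cast
  ring

lemma eval_eq_zero_of_eq_neg_one (hl : IsLineArrangement l) (hD : IsTwisted l D) {α : ι → ℂ} {i : ι}
    (hi : α i = -1) {b : MvPolynomial ι ℂ} (hb : b ∈ Bideal l D) : eval α b = 0 := by
  obtain ⟨P, hP, hPb⟩ := hb
  have hmem : P (toLoc l (prodForm l)) ∈ vanishingSubmodule l α i := by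
    refine Wa_induction _ ?_ ?_ hP _ ⟨0, prodForm l, by simp, ?_⟩
    · rintro z m ⟨k, r, h, hr⟩
      refine ⟨k, X z * r, ?_, ?_⟩
      · rw [map_mul, ← h, mul_left_comm]
      · rw [map_mul]
        exact hr.mul_left _
    · rintro v m ⟨k, r, h, hr⟩
      obtain ⟨r', h', hr'⟩ := hD.exists_numerator α v h
      refine ⟨k + 1, r', h', ?_⟩
      rw [hr']
      exact pow_dvd_nabla (by rw [hi]; ring) hr v
    · rw [zero_add, pow_one, specialize_inl]
      exact Finset.dvd_prod_of_mem l (Finset.mem_univ i)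
  rw [← hPb] at hmem
  obtain ⟨k, r, h, hr⟩ := hmem
  rw [← map_pow, ← map_mul] at h
  rw [← hl.toLoc_injective h, map_mul, map_pow, specialize_inl, specialize_inr,
    ← mul_cofactor l i, mul_pow, mul_assoc, pow_succ,
    mul_dvd_mul_iff_left (pow_ne_zero _ (hl.ne_zero i))] at hr
  by_contra hne
  rcases (hl.prime i).dvd_or_dvd hr with hdvd | hdvd
  · exact hl.not_dvd_cofactor i ((hl.prime i).dvd_of_dvd_pow hdvd)
  · exact hl.not_dvd_C i hne hdvd

/-- The subspace `F · ℂ[x, s] + D₀ M + D₁ M` of `M`. -/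
noncomputable def exactSubmodule (l : ι → MvPolynomial (Fin 2) ℂ)
    (D : Fin 2 → Module.End ℂ (Loc l)) : Submodule ℂ (Loc l) :=
  (Submodule.span (MvPolynomial (Fin 2 ⊕ ι) ℂ) {toLoc l (prodForm l)}).restrictScalars ℂ ⊔
    (LinearMap.range (D 0) ⊔ LinearMap.range (D 1))

lemma toLoc_mul_mem_exactSubmodule (hD : IsTwisted l D) {b : MvPolynomial ι ℂ}
    (hb : b ∈ Bideal l D) (γ : MvPolynomial (Fin 2 ⊕ ι) ℂ) :
    toLoc l γ * toLoc l (rename Sum.inr b) ∈ exactSubmodule l D := by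
  obtain ⟨P, hP, hPb⟩ := hb
  let T : Submodule ℂ (Loc l) :=
    { carrier := {m | ∀ γ, toLoc l γ * m ∈ exactSubmodule l D}
      zero_mem' := fun γ => by simp
      add_mem' := fun h₁ h₂ γ => by rw [mul_add]; exact add_mem (h₁ γ) (h₂ γ)
      smul_mem' := fun c m h γ => by
        rw [mul_smul_comm]; exact Submodule.smul_mem _ c (h γ) }
  have hmem : P (toLoc l (prodForm l)) ∈ T := by
    refine Wa_induction T ?_ ?_ hP _ fun γ => ?_
    · intro z m hm γ
      rw [← mul_assoc, ← map_mul]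
      exact hm _
    · intro v m hm γ
      have h1 : toLoc l γ * D v m =
          D v (toLoc l γ * m) - toLoc l (pderiv (Sum.inl v) γ) * m := by
        rw [hD.apply_mul]
        ring
      rw [h1]
      refine sub_mem (Submodule.mem_sup_right ?_) (hm _)
      fin_cases v
      · exact Submodule.mem_sup_left ⟨_, rfl⟩
      · exact Submodule.mem_sup_right ⟨_, rfl⟩
    · refine Submodule.mem_sup_left ?_
      rw [Submodule.restrictScalars_mem, ← Algebra.smul_def]
      exact Submodule.smul_mem _ _ (Submodule.mem_span_singleton_self _)
  rw [hPb]
  exact hmem γ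

lemma eval_eq_zero_of_sum_eq (hl : IsLineArrangement l) (hD : IsTwisted l D)
    (hp : 3 ≤ Fintype.card ι) {j : ℕ} (hj : j ≤ 2 * (Fintype.card ι - 2)) {α : ι → ℂ}
    (hα : ∀ i (z : ℤ), α i ≠ z) (hsum : ∑ i, α i = -2 - j) {b : MvPolynomial ι ℂ}
    (hb : b ∈ Bideal l D) : eval α b = 0 := by
  refine hl.eq_zero_of_forall_exact hp hj hα hsum fun γ => ?_
  obtain ⟨m, hm, d, hd, h⟩ := Submodule.mem_sup.1
    (toLoc_mul_mem_exactSubmodule hD hb (rename Sum.inl γ))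
  obtain ⟨_, ⟨u, rfl⟩, _, ⟨v, rfl⟩, rfl⟩ := Submodule.mem_sup.1 hd
  obtain ⟨g, rfl⟩ := Submodule.mem_span_singleton.1 hm
  obtain ⟨k₁, r₁, h₁⟩ := exists_toLoc_eq u
  obtain ⟨k₂, r₂, h₂⟩ := exists_toLoc_eq v
  have h₁' : toLoc l (prodForm l) ^ (k₁ + k₂) * u = toLoc l (prodForm l ^ k₂ * r₁) := by
    rw [map_mul, map_pow, ← h₁]
    ring
  have h₂' : toLoc l (prodForm l) ^ (k₁ + k₂) * v = toLoc l (prodForm l ^ k₁ * r₂) := by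
    rw [map_mul, map_pow, ← h₂]
    ring
  obtain ⟨s₁, hs₁, he₁⟩ := hD.exists_numerator α 0 h₁'
  obtain ⟨s₂, hs₂, he₂⟩ := hD.exists_numerator α 1 h₂'
  refine ⟨k₁ + k₂, specialize α g, specialize α (prodForm l ^ k₂ * r₁),
    specialize α (prodForm l ^ k₁ * r₂), ?_⟩
  rw [← he₁, ← he₂, ← map_add]
  have key : prodForm l ^ (k₁ + k₂ + 1) * (rename Sum.inl γ * rename Sum.inr b -
      g * prodForm l) = s₁ + s₂ := by
    refine hl.toLoc_injective ?_
    rw [map_add, ← hs₁, ← hs₂]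
    simp only [map_mul, map_sub, map_pow]
    rw [← h, Algebra.smul_def]
    ring
  rw [← key]
  simp only [map_mul, map_sub, map_pow, specialize_inl, specialize_inr]
  ring

lemma X_add_one_dvd (hl : IsLineArrangement l) (hD : IsTwisted l D) {b : MvPolynomial ι ℂ}
    (hb : b ∈ Bideal l D) (i : ι) : X i + 1 ∣ b := by
  classical
  have h := X_sub_dvd (i := i) (r := -1) (b := b) Set.infinite_univ fun α _ =>
    eval_eq_zero_of_eq_neg_one (i := i) hl hD (by simp) hb
  rwa [sub_neg_eq_add] at h

lemma infinite_im_pos : {z : ℂ | 0 < z.im}.Infinite := by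
  refine Set.infinite_of_injective_forall_mem (f := fun n : ℕ => ((n : ℂ) + Complex.I))
    (fun m n h => by simpa using h) fun n => by simp

lemma sum_X_add_dvd (hl : IsLineArrangement l) (hD : IsTwisted l D)
    (hp : 3 ≤ Fintype.card ι) {j : ℕ} (hj : j ≤ 2 * (Fintype.card ι - 2)) {b : MvPolynomial ι ℂ}
    (hb : b ∈ Bideal l D) : (∑ i, X i) + C ((2 : ℂ) + j) ∣ b := by
  classical
  obtain ⟨i₀, i₁, hi⟩ := Fintype.exists_pair_of_one_lt_card (α := ι) (by omega)
  have h := X_sub_dvd (i := i₀) (r := C (-2 - j : ℂ) - ∑ k ∈ Finset.univ.erase i₀, X k) (b := b)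
    infinite_im_pos fun α hα => ?_
  · convert h using 1
    rw [← Finset.add_sum_erase _ _ (Finset.mem_univ i₀)]
    simp only [C_sub, C_neg, C_add]
    ring
  · simp only [map_sub, eval_C, map_sum, eval_X]
    refine eval_eq_zero_of_sum_eq hl hD hp hj (fun i z hz => ?_) ?_ hb
    · replace hz := congrArg Complex.im hz
      rcases eq_or_ne i i₀ with rfl | hi'
      · have hpos : 0 < ∑ k ∈ Finset.univ.erase i, (α k).im :=
          Finset.sum_pos (fun k _ => hα k) ⟨i₁, by simpa using hi.symm⟩
        have hsum := Finset.add_sum_erase Finset.univ (fun k => (α k).im) (Finset.mem_univ i)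
        simp at hz
        linarith
      · rw [Function.update_of_ne hi', Complex.intCast_im] at hz
        exact (hα i).ne' hz
    · rw [← Finset.add_sum_erase _ _ (Finset.mem_univ i₀), Function.update_self]
      rw [Finset.sum_congr rfl fun k hk => Function.update_of_ne (Finset.ne_of_mem_erase hk) _ _]
      ring

end Necessity

section Sufficiency

variable {ι : Type} [Fintype ι] {l : ι → MvPolynomial (Fin 2) ℂ} {D : Fin 2 → Module.End ℂ (Loc l)}

/-- The submodule `W · F` of `M`. -/
noncomputable def orbit (l : ι → MvPolynomial (Fin 2) ℂ) (D : Fin 2 → Module.End ℂ (Loc l)) :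
    Submodule ℂ (Loc l) :=
  (Subalgebra.toSubmodule (Wa l D)).map (LinearMap.applyₗ (toLoc l (prodForm l)))

lemma mem_orbit {m : Loc l} : m ∈ orbit l D ↔ ∃ P ∈ Wa l D, P (toLoc l (prodForm l)) = m :=
  Iff.rfl

lemma mem_Bideal_iff {b : MvPolynomial ι ℂ} :
    b ∈ Bideal l D ↔ toLoc l (rename Sum.inr b) ∈ orbit l D := by
  rw [mem_orbit]
  exact exists_congr fun P => and_congr_right fun _ => eq_comm

lemma mulLeft_mem_Wa (r : MvPolynomial (Fin 2 ⊕ ι) ℂ) :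
    LinearMap.mulLeft ℂ (toLoc l r) ∈ Wa l D := by
  induction r using MvPolynomial.induction_on with
  | C c =>
    convert (Wa l D).algebraMap_mem c using 1
    ext m
    exact toLoc_C_mul c m
  | add p q hp hq =>
    convert add_mem hp hq using 1
    ext m
    simp [add_mul]
  | mul_X p z hp =>
    have hz : LinearMap.mulLeft ℂ (toLoc l (X z)) ∈ Wa l D := by
      refine Algebra.subset_adjoin (Or.inl ?_)
      rcases z with i | j
      · exact Or.inl ⟨i, rfl⟩
      · exact Or.inr ⟨j, rfl⟩
    convert mul_mem hp hz using 1
    ext m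
    simp

lemma toLoc_mul_mem_orbit (r : MvPolynomial (Fin 2 ⊕ ι) ℂ) {m : Loc l} (hm : m ∈ orbit l D) :
    toLoc l r * m ∈ orbit l D := by
  obtain ⟨P, hP, rfl⟩ := mem_orbit.1 hm
  exact mem_orbit.2 ⟨_, mul_mem (mulLeft_mem_Wa r) hP, rfl⟩

lemma apply_mem_orbit (v : Fin 2) {m : Loc l} (hm : m ∈ orbit l D) : D v m ∈ orbit l D := by
  obtain ⟨P, hP, rfl⟩ := mem_orbit.1 hm
  exact mem_orbit.2 ⟨_, mul_mem (Algebra.subset_adjoin (Or.inr ⟨v, rfl⟩)) hP, rfl⟩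

lemma toLoc_mem_orbit_of_dvd {r : MvPolynomial (Fin 2 ⊕ ι) ℂ} (h : prodForm l ∣ r) :
    toLoc l r ∈ orbit l D := by
  obtain ⟨g, rfl⟩ := h
  rw [mul_comm, map_mul]
  exact toLoc_mul_mem_orbit g (mem_orbit.2 ⟨1, one_mem _, rfl⟩)

lemma IsTwisted.apply_prodForm_mul (hD : IsTwisted l D) (v : Fin 2) (h : MvPolynomial (Fin 2) ℂ) :
    D v (toLoc l (prodForm l * rename Sum.inl h)) =
      toLoc l (prodForm l * rename Sum.inl (pderiv v h) +
        ∑ j, (X (Sum.inr j) + 1) * rename Sum.inl (pderiv v (l j) * cofactor l j * h)) := by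
  have h1 := hD.prodForm_mul_one v
  have h2 : ∑ j, (X (Sum.inr j) + 1) * rename Sum.inl (pderiv v (l j) * cofactor l j * h) =
      (logForm l v + pderiv (Sum.inl v) (prodForm l)) * rename Sum.inl h := by
    rw [pderiv_prodForm, logForm, ← Finset.sum_add_distrib, Finset.sum_mul]
    refine Finset.sum_congr rfl fun j _ => ?_
    simp only [map_mul]
    ring
  rw [hD.apply_toLoc, h2, pderiv_mul, pderiv_rename Sum.inl_injective v h]
  simp only [map_add, map_mul] at h1 ⊢
  linear_combination toLoc l (rename Sum.inl h) * h1

/-- A form which, up to the factor `s_i + 1`, lies in `W · F`, and which vanishes on all lines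
but the `i`-th one. -/
lemma IsLineArrangement.exists_mem_orbit (hl : IsLineArrangement l) (hD : IsTwisted l D)
    (hp : 3 ≤ Fintype.card ι) (i : ι) :
    ∃ e : MvPolynomial (Fin 2) ℂ, e.IsHomogeneous (2 * Fintype.card ι - 3) ∧ ¬ l i ∣ e ∧
      (∀ j, j ≠ i → l j ∣ e) ∧
      toLoc l ((X (Sum.inr i) + 1) * rename Sum.inl e) ∈ orbit l D := by
  classical
  obtain ⟨k, hk⟩ := Fintype.exists_ne_of_one_lt_card (by omega : 1 < Fintype.card ι) i
  have hki : k ∈ Finset.univ.erase i := by simpa using hk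
  set s := (Finset.univ.erase i).erase k with hs
  set h := ∏ j ∈ s, l j with hh
  have hcard : s.card = Fintype.card ι - 2 := by
    rw [hs, Finset.card_erase_of_mem hki, Finset.card_erase_of_mem (Finset.mem_univ i),
      Finset.card_univ]
    omega
  obtain ⟨a, b, hab⟩ := isHomogeneous_one_eq (hl.homogeneous k)
  obtain ⟨a', b', hab'⟩ := isHomogeneous_one_eq (hl.homogeneous i)
  have hk0 : pderiv 0 (l k) = C a := by rw [hab]; simp [pderiv_X]
  have hk1 : pderiv 1 (l k) = C b := by rw [hab]; simp [pderiv_X]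
  have hi0 : pderiv 0 (l i) = C a' := by rw [hab']; simp [pderiv_X]
  have hi1 : pderiv 1 (l i) = C b' := by rw [hab']; simp [pderiv_X]
  have hne : b * a' - a * b' ≠ 0 := by
    intro h0
    refine hl.not_dvd hk ?_
    rw [hab]
    refine dvd_of_eval_eq_zero ?_ (hl.homogeneous i) ?_
    · by_contra! h1
      exact hl.ne_zero k (by simp [hab, h1.1, h1.2])
    · rw [hab']
      simp only [map_add, map_mul, eval_C, eval_X, Matrix.cons_val_zero, Matrix.cons_val_one,
        Matrix.cons_val_fin_one]
      linear_combination h0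
  set δ : ι → MvPolynomial (Fin 2) ℂ := fun j => C b * pderiv 0 (l j) - C a * pderiv 1 (l j)
    with hδ
  have hδi : δ i = C (b * a' - a * b') := by simp only [hδ, hi0, hi1, C_sub, C_mul]
  have hδk : δ k = 0 := by simp only [hδ, hk0, hk1]; ring
  have hmem : toLoc l (C b * (prodForm l * rename Sum.inl (pderiv 0 h)) -
      C a * (prodForm l * rename Sum.inl (pderiv 1 h)) +
      ∑ j, (X (Sum.inr j) + 1) * rename Sum.inl (δ j * cofactor l j * h)) ∈ orbit l D := by
    have h0 : ∀ v, D v (toLoc l (prodForm l * rename Sum.inl h)) ∈ orbit l D := fun v =>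
      apply_mem_orbit v (toLoc_mem_orbit_of_dvd (dvd_mul_right _ _))
    convert sub_mem (toLoc_mul_mem_orbit (C b) (h0 0)) (toLoc_mul_mem_orbit (C a) (h0 1)) using 1
    rw [hD.apply_prodForm_mul, hD.apply_prodForm_mul, ← map_mul (toLoc l), ← map_mul (toLoc l),
      ← map_sub (toLoc l)]
    congr 1
    rw [mul_add, mul_add, add_sub_add_comm, Finset.mul_sum, Finset.mul_sum,
      ← Finset.sum_sub_distrib]
    congr 1
    refine Finset.sum_congr rfl fun j _ => ?_
    simp only [hδ, map_mul, map_sub, rename_C]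
    ring
  have hrest : prodForm l ∣ ∑ j ∈ Finset.univ.erase i,
      (X (Sum.inr j) + 1) * rename Sum.inl (δ j * cofactor l j * h) := by
    refine Finset.dvd_sum fun j hj => Dvd.dvd.mul_left ?_ _
    rcases eq_or_ne j k with rfl | hjk
    · simp [hδk]
    · refine map_dvd (rename Sum.inl) ?_
      rw [← mul_cofactor l j, mul_comm (l j), mul_assoc]
      refine Dvd.dvd.mul_left (mul_dvd_mul_left _ ?_) _
      exact Finset.dvd_prod_of_mem l (Finset.mem_erase.2 ⟨hjk, hj⟩)
  rw [← Finset.add_sum_erase _ _ (Finset.mem_univ i)] at hmem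
  refine ⟨δ i * cofactor l i * h, ?_, fun h0 => ?_, fun j hj => ?_, ?_⟩
  · rw [hδi]
    convert ((hl.cofactor_isHomogeneous i).C_mul _).mul (hl.prod_isHomogeneous s) using 1
    omega
  · rw [hδi] at h0
    rcases (hl.prime i).dvd_or_dvd h0 with h0 | h0
    · rcases (hl.prime i).dvd_or_dvd h0 with h0 | h0
      · exact hl.not_dvd_C i hne h0
      · exact hl.not_dvd_cofactor i h0
    · exact hl.not_dvd_prod (by simp [hs]) h0
  · exact ((dvd_cofactor hj).mul_left _).mul_right _
  · have h2 := sub_mem hmem (toLoc_mem_orbit_of_dvd (D := D) (dvd_add (dvd_sub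
      ((dvd_mul_right (prodForm l) (rename Sum.inl (pderiv 0 h))).mul_left (C b))
      ((dvd_mul_right (prodForm l) (rename Sum.inl (pderiv 1 h))).mul_left (C a))) hrest))
    rw [← map_sub] at h2
    convert h2 using 2
    ring

lemma IsLineArrangement.mem_orbit_of_isHomogeneous (hl : IsLineArrangement l) (hD : IsTwisted l D)
    (hp : 3 ≤ Fintype.card ι) {f : MvPolynomial (Fin 2) ℂ}
    (hf : f.IsHomogeneous (2 * Fintype.card ι - 3)) :
    toLoc l (rename Sum.inr (∏ i, (X i + 1)) * rename Sum.inl f) ∈ orbit l D := by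
  classical
  choose e he hie hje hmem using hl.exists_mem_orbit hD hp
  choose c hc using fun i =>
    exists_dvd_sub_smul (hl.homogeneous i) (hl.ne_zero i) hf (he i) (hie i)
  obtain ⟨g, hg⟩ : ∏ i, l i ∣ f - ∑ i, C (c i) * e i := by
    refine hl.prod_dvd fun i _ => ?_
    rw [← Finset.add_sum_erase _ _ (Finset.mem_univ i), ← sub_sub]
    exact dvd_sub (hc i) (Finset.dvd_sum fun j hj =>
      (hje j i (Finset.ne_of_mem_erase hj).symm).mul_left _)
  rw [sub_eq_iff_eq_add.1 hg, map_add, mul_add, map_add]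
  refine add_mem (toLoc_mem_orbit_of_dvd ?_) ?_
  · exact (map_dvd (rename Sum.inl) (dvd_mul_right _ _)).mul_left _
  · rw [map_sum, Finset.mul_sum, map_sum]
    refine sum_mem fun i _ => ?_
    convert toLoc_mul_mem_orbit
      (rename Sum.inr (∏ j ∈ Finset.univ.erase i, (X j + 1)) * C (c i)) (hmem i) using 1
    rw [← map_mul, ← Finset.mul_prod_erase _ (fun j => (X j + 1 : MvPolynomial ι ℂ))
      (Finset.mem_univ i)]
    congr 1
    simp only [map_mul, map_add, rename_C, rename_X, map_one]
    ring

lemma IsTwisted.sum_X_mul_one (hl : IsLineArrangement l) (hD : IsTwisted l D) :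
    toLoc l (X (Sum.inl 0)) * D 0 1 + toLoc l (X (Sum.inl 1)) * D 1 1 =
      toLoc l (∑ j, X (Sum.inr j)) := by
  refine isUnit_toLoc_prodForm.mul_left_cancel ?_
  have h0 := hD.prodForm_mul_one 0
  have h1 := hD.prodForm_mul_one 1
  have key : X (Sum.inl 0) * logForm l 0 + X (Sum.inl 1) * logForm l 1 =
      prodForm l * ∑ j, X (Sum.inr j) := by
    rw [logForm, logForm, Finset.mul_sum, Finset.mul_sum, Finset.mul_sum,
      ← Finset.sum_add_distrib]
    refine Finset.sum_congr rfl fun j _ => ?_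
    have h2 := (hl.homogeneous j).sum_X_mul_pderiv
    rw [Fin.sum_univ_two, one_smul] at h2
    rw [prodForm, ← mul_cofactor l j]
    conv_rhs => rw [← h2]
    simp only [map_mul, map_add, rename_X]
    ring
  rw [← map_mul, ← key]
  simp only [map_add, map_mul]
  linear_combination toLoc l (X (Sum.inl 0)) * h0 + toLoc l (X (Sum.inl 1)) * h1

lemma IsTwisted.sum_apply_X_mul (hl : IsLineArrangement l) (hD : IsTwisted l D) {d : ℕ}
    {f : MvPolynomial (Fin 2) ℂ} (hf : f.IsHomogeneous d) (b : MvPolynomial ι ℂ) :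
    D 0 (toLoc l (rename Sum.inr b * rename Sum.inl (X 0 * f))) +
      D 1 (toLoc l (rename Sum.inr b * rename Sum.inl (X 1 * f))) =
      toLoc l (rename Sum.inr ((∑ i, X i + C (2 + (d : ℂ))) * b) * rename Sum.inl f) := by
  have h1 := hD.sum_X_mul_one hl
  have h2 := congrArg (rename (Sum.inl : Fin 2 → Fin 2 ⊕ ι)) hf.sum_X_mul_pderiv
  rw [Fin.sum_univ_two, nsmul_eq_mul] at h2
  have h3 := congrArg (toLoc l) h2
  have h4 : rename Sum.inr (∑ i, X i + C (2 + (d : ℂ)) : MvPolynomial ι ℂ) =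
      (∑ i, X (Sum.inr i) + (2 + (d : MvPolynomial (Fin 2 ⊕ ι) ℂ))) := by
    simp only [map_add, map_sum, rename_X, map_natCast, map_ofNat]
  rw [hD.apply_toLoc, hD.apply_toLoc, map_mul (rename Sum.inr), h4]
  simp only [pderiv_mul, pderiv_inl_rename_inr, pderiv_rename Sum.inl_injective, map_mul, map_add,
    rename_X, map_natCast, map_ofNat, pderiv_X_self, map_one, map_zero] at h1 h3 ⊢
  linear_combination toLoc l (rename Sum.inr b) * toLoc l (rename Sum.inl f) * h1 +
    toLoc l (rename Sum.inr b) * h3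

lemma IsLineArrangement.prod_mul_mem_orbit (hl : IsLineArrangement l) (hD : IsTwisted l D)
    (hp : 3 ≤ Fintype.card ι) (m : ℕ) {d : ℕ} (hd : d + m = 2 * Fintype.card ι - 3)
    {f : MvPolynomial (Fin 2) ℂ} (hf : f.IsHomogeneous d) :
    toLoc l (rename Sum.inr ((∏ j ∈ Finset.range m, (∑ i, X i + C (2 + ((d + j : ℕ) : ℂ)))) *
      ∏ i, (X i + 1)) * rename Sum.inl f) ∈ orbit l D := by
  induction m generalizing d f with
  | zero =>
    rw [Finset.prod_range_zero, one_mul]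
    exact hl.mem_orbit_of_isHomogeneous hD hp (hd ▸ hf)
  | succ m ih =>
    have h1 : ∀ v : Fin 2, (X v * f).IsHomogeneous (d + 1) := fun v => by
      rw [add_comm]
      exact (isHomogeneous_X ℂ v).mul hf
    have h2 := add_mem (apply_mem_orbit 0 (ih (by omega) (h1 0)))
      (apply_mem_orbit 1 (ih (by omega) (h1 1)))
    rw [hD.sum_apply_X_mul hl hf, ← mul_assoc] at h2
    rw [Finset.prod_range_succ', mul_comm (∏ _ ∈ _, _) (_ + _)]
    simpa only [add_zero, add_assoc, add_comm 1] using h2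

lemma IsLineArrangement.mul_mem_Bideal (hl : IsLineArrangement l) (hD : IsTwisted l D)
    (hp : 3 ≤ Fintype.card ι) (c : MvPolynomial ι ℂ) :
    (∏ i, (X i + 1)) * (∏ j ∈ Finset.range (2 * (Fintype.card ι - 2) + 1),
      (∑ i, X i + C ((2 : ℂ) + j))) * c ∈ Bideal l D := by
  rw [mem_Bideal_iff]
  have h := hl.prod_mul_mem_orbit hD hp (2 * (Fintype.card ι - 2) + 1) (d := 0) (by omega)
    (isHomogeneous_one (Fin 2) ℂ)
  convert toLoc_mul_mem_orbit (rename Sum.inr c) h using 1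
  rw [← map_mul, map_one, mul_one, ← map_mul]
  simp only [zero_add]
  congr 2
  ring

end Sufficiency

section Generator

variable {ι : Type} [Fintype ι]

/-- The product of the linear factors of the generator divides each of their common multiples. -/
lemma generator_dvd {n : ℕ} {b : MvPolynomial ι ℂ} (h₁ : ∀ i, X i + 1 ∣ b)
    (h₂ : ∀ j < n, (∑ i, X i) + C ((2 : ℂ) + (j : ℕ)) ∣ b) :
    (∏ i, (X i + 1)) * (∏ j ∈ Finset.range n, (∑ i, X i + C ((2 : ℂ) + j))) ∣ b := by
  classical
  have hirr : ∀ i : ι, Irreducible (X i + 1 : MvPolynomial ι ℂ) := fun i => by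
    refine irreducible_of_totalDegree_eq_one ?_ fun x hx => isUnit_of_dvd_one ?_
    · rw [totalDegree_add_eq_left_of_totalDegree_lt] <;> simp
    · simpa using hx 0
  have hrel : ∀ (i : ι) (q : MvPolynomial ι ℂ), eval (Pi.single i (-1)) q ≠ 0 →
      IsRelPrime (X i + 1) q := fun i q hq => by
    refine (hirr i).isRelPrime_iff_not_dvd.2 fun h => hq ?_
    obtain ⟨r, rfl⟩ := h
    simp
  refine IsRelPrime.mul_dvd ?_ ?_ ?_
  · refine IsRelPrime.prod_left fun i _ => IsRelPrime.prod_right fun j _ => hrel i _ ?_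
    have h : eval (Pi.single i (-1)) ((∑ k, X k : MvPolynomial ι ℂ) + C ((2 : ℂ) + j)) =
        ((j + 1 : ℕ) : ℂ) := by
      simp only [map_add, map_sum, eval_X, eval_C, Finset.sum_pi_single', Finset.mem_univ, if_true]
      push_cast
      ring
    rw [h]
    exact Nat.cast_ne_zero.2 j.succ_ne_zero
  · refine Finset.prod_dvd_of_isRelPrime (fun i _ k _ hik => hrel i _ ?_) fun i _ => h₁ i
    simp [Pi.single_eq_of_ne hik.symm]
  · refine Finset.prod_dvd_of_isRelPrime (fun j _ k _ hjk => IsCoprime.isRelPrime ?_)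
      fun j hj => h₂ j (Finset.mem_range.1 hj)
    have hjk' : ((j : ℂ) - k) ≠ 0 := sub_ne_zero.2 (Nat.cast_injective.ne hjk)
    have h : (C ((j : ℂ) - k)⁻¹ * (C (j : ℂ) - C (k : ℂ)) : MvPolynomial ι ℂ) = 1 := by
      rw [← C_sub, ← C_mul, inv_mul_cancel₀ hjk', C_1]
    refine ⟨C ((j : ℂ) - k)⁻¹, -C ((j : ℂ) - k)⁻¹, ?_⟩
    simp only [C_add]
    linear_combination h

end Generator

end Arrangement
open Arrangement in
/-- For `p ≥ 3` pairwise non-proportional linear forms on `ℂ²`, the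
Bernstein ideal is the principal ideal generated by
`(∏ᵢ (sᵢ + 1)) · ∏_{j=0}^{2(p−2)} (s₁ + ⋯ + s_p + 2 + j)`. -/
theorem bernstein_ideal_dim_two
    (p : ℕ) (hp : 3 ≤ p) (l : Fin p → MvPolynomial (Fin 2) ℂ)
    (hl0 : ∀ i, l i ≠ 0) (hlh : ∀ i, (l i).IsHomogeneous 1)
    (hprop : ∀ i j, i ≠ j → ∀ c : ℂ, l i ≠ c • l j)
    (D : Fin 2 → Module.End ℂ
      (Localization.Away (rename Sum.inl (∏ i, l i) : MvPolynomial (Fin 2 ⊕ Fin p) ℂ)))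
    (hD : IsTwisted l D) :
    Bideal l D =
      ↑(Ideal.span {(∏ i : Fin p, (X i + 1)) *
          ∏ j ∈ Finset.range (2 * (p - 2) + 1),
            ((∑ i : Fin p, X i) + C ((2 : ℂ) + (j : ℂ)))}) := by
  have hl : IsLineArrangement l := ⟨hl0, hlh, hprop⟩
  have hcard : 3 ≤ Fintype.card (Fin p) := by rwa [Fintype.card_fin]
  ext b
  rw [SetLike.mem_coe, Ideal.mem_span_singleton]
  refine ⟨fun hb => ?_, ?_⟩
  · refine generator_dvd (X_add_one_dvd hl hD hb) fun j hj =>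
      sum_X_add_dvd hl hD hcard (by rw [Fintype.card_fin]; omega) hb
  · rintro ⟨c, rfl⟩
    simpa only [Fintype.card_fin] using hl.mul_mem_Bideal hD hcard c
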